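/- arXiv:2411.09005 — 2 statements merged into one kernel-verified Lean document; each statement's English description precedes it below -/
import Mathlib

section
/- For every integer k≥2, the alternating sum of the coefficients c_{n,k} vanishes: ∑_{n=0}^{k} (−1)^{k−n} c_{n,k} = 0. -/
/-- The integer coefficients `c_{n,k}`. -/
def cCoef : ℕ → ℕ → ℤ
  | 0, 0 => 1
  | _ + 1, 0 => 0
  | 0, k + 1 => cCoef 0 k + cCoef 1 k
  | 1, k + 1 => cCoef 0 k + 2 * (cCoef 1 k + cCoef 2 k)
  | n + 2, k + 1 => ((n : ℤ) + 1) * cCoef (n + 1) k + 2 * ((n : ℤ) + 2) * cCoef (n + 2) k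
      + ((n : ℤ) + 3) * cCoef (n + 3) k

theorem cCoef_zero_of_lt (k : ℕ) : ∀ n, k < n → cCoef n k = 0 := by
  induction k with
  | zero =>
    intro n hn
    obtain ⟨m, rfl⟩ : ∃ m, n = m + 1 := ⟨n - 1, by omega⟩
    simp [cCoef]
  | succ k ih =>
    intro n hn
    obtain ⟨m, rfl⟩ : ∃ m, n = m + 2 := ⟨n - 2, by omega⟩
    rw [cCoef, ih _ (by omega), ih _ (by omega), ih _ (by omega)]
    ring

theorem cCoef_partial (k M : ℕ) :
    ∑ n ∈ Finset.range (M + 2), (-1 : ℤ) ^ n * cCoef n (k + 1)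
      = (-1) ^ (M + 1) * (((M : ℤ) + 1) * cCoef (M + 1) k + ((M : ℤ) + 2) * cCoef (M + 2) k) := by
  induction M with
  | zero =>
    simp [Finset.sum_range_succ, cCoef]
    ring
  | succ M ih =>
    rw [Finset.sum_range_succ, ih, cCoef]
    push_cast
    ring

/-- For every `k ≥ 2`, `∑_{n=0}^{k} (−1)^{k−n} c_{n,k} = 0`. -/
theorem alternating_sum_cCoef_eq_zero (k : ℕ) (hk : 2 ≤ k) :
    ∑ n ∈ Finset.range (k + 1), (-1 : ℤ) ^ (k - n) * cCoef n k = 0 := by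
  obtain ⟨j, rfl⟩ : ∃ j, k = j + 1 := ⟨k - 1, by omega⟩
  have h := cCoef_partial j j
  rw [cCoef_zero_of_lt j (j + 1) (by omega), cCoef_zero_of_lt j (j + 2) (by omega)] at h
  have e : ∑ n ∈ Finset.range (j + 1 + 1), (-1 : ℤ) ^ (j + 1 - n) * cCoef n (j + 1)
      = (-1) ^ (j + 1) * ∑ n ∈ Finset.range (j + 2), (-1 : ℤ) ^ n * cCoef n (j + 1) := by
    rw [Finset.mul_sum]
    refine Finset.sum_congr rfl fun n hn => ?_
    have hn' : n ≤ j + 1 := by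
      have := Finset.mem_range.mp hn
      omega
    obtain ⟨d, hd⟩ := Nat.exists_eq_add_of_le hn'
    have h1 : (-1 : ℤ) ^ n * (-1) ^ n = 1 := by
      rw [← mul_pow]
      simp
    rw [hd, Nat.add_sub_cancel_left, pow_add]
    linear_combination (-(-1 : ℤ) ^ d * cCoef n (n + d)) * h1
  rw [e, h]
  simp
end

section
/- Let 0<ν≤1, α>0, λ>0 with kλ≠α for every positive integer k. Then for every u with 0≤u<1 and every z>0, the Laplace transform of the probability generating function G(u,t)=∑_{n=0}^∞ u^n p̄(n,t) of the TFLBPwI satisfies ∫_0^∞ e^{−zt} G(u,t) dt = z^{ν−1}/(z^ν+α) + (α/(z^ν+α)) ∫_0^∞ ( u e^{−λx} / (1 − u(1 − e^{−λx})) ) e^{−x z^ν} z^{ν−1} dx. -/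
open MeasureTheory

/-- The Mittag-Leffler function `E_ν(x) = ∑_{k≥0} x^k / Γ(kν+1)`. -/
noncomputable def ML (ν x : ℝ) : ℝ := ∑' k : ℕ, x ^ k / Real.Gamma ((k : ℝ) * ν + 1)

/-- The state probabilities `p̄(n,t)` of the time-fractional linear birth process
with immigration (TFLBPwI). -/
noncomputable def pbar (ν α lam : ℝ) (n : ℕ) (t : ℝ) : ℝ :=
  if n = 0 then ML ν (-α * t ^ ν)
  else ∑ k ∈ Finset.Icc 1 n,
    ((n - 1).choose (k - 1) : ℝ) * (-1 : ℝ) ^ k * (α / ((k : ℝ) * lam - α)) *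
      (ML ν (-((k : ℝ) * lam) * t ^ ν) - ML ν (-α * t ^ ν))

noncomputable def EE (ν : ℝ) : ℕ → (ℕ → ℝ) → ℝ
  | 0, g => g 0
  | n + 1, g => EE ν n (fun j => (1 - ν * (j + 1) / (n + 1)) * g j + (ν * (j + 1) / (n + 1)) * g (j + 1))

lemma EE_add (ν : ℝ) (n : ℕ) (f g : ℕ → ℝ) :
    EE ν n (fun j => f j + g j) = EE ν n f + EE ν n g := by
  induction n generalizing f g with
  | zero => rfl
  | succ n ih =>
    simp only [EE]
    rw [← ih]
    congr 1; funext j; ring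

lemma EE_mul (ν : ℝ) (n : ℕ) (c : ℝ) (f : ℕ → ℝ) :
    EE ν n (fun j => c * f j) = c * EE ν n f := by
  induction n generalizing f with
  | zero => rfl
  | succ n ih =>
    simp only [EE]
    rw [← ih]
    congr 1; funext j; ring

lemma EE_nonneg (ν : ℝ) (h0 : 0 < ν) (h1 : ν ≤ 1) (n : ℕ) (f : ℕ → ℝ) (hf : ∀ j, j ≤ n → 0 ≤ f j) :
    0 ≤ EE ν n f := by
  induction n generalizing f with
  | zero => exact hf 0 le_rfl
  | succ n ih =>
    simp only [EE]
    refine ih _ fun j hj => ?_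
    have hj' : (j : ℝ) ≤ n := by exact_mod_cast hj
    have h2 : ν * (j + 1) / (n + 1) ≤ 1 := by
      rw [div_le_one (by positivity)]
      nlinarith [(Nat.cast_nonneg j : (0:ℝ) ≤ j)]
    have h3 := hf j (by omega)
    have h4 := hf (j+1) (by omega)
    have : 0 ≤ 1 - ν * (j + 1) / (n + 1) := by linarith
    positivity

lemma EE_one (ν : ℝ) (n : ℕ) : EE ν n (fun _ => 1) = 1 := by
  induction n with
  | zero => rfl
  | succ n ih =>
    simp only [EE]
    rw [← ih]
    congr 1; funext j; rw [ih]; ring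

lemma EE_hasSum (ν : ℝ) (n : ℕ) (a : ℕ → ℕ → ℝ) (g : ℕ → ℝ)
    (h : ∀ j, HasSum (fun m => a m j) (g j)) : HasSum (fun m => EE ν n (a m)) (EE ν n g) := by
  induction n generalizing a g with
  | zero => exact h 0
  | succ n ih =>
    simp only [EE]
    exact ih _ _ fun j => ((h j).mul_left _).add ((h (j+1)).mul_left _)

noncomputable def PP (n : ℕ) (a : ℝ) : ℝ := ∏ j ∈ Finset.range n, (1 + a / (j + 1))

lemma EE_choose (ν : ℝ) (n m : ℕ) :
    EE ν n (fun j => ((m + j).choose j : ℝ)) = PP n (m * ν) := by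
  induction n with
  | zero => simp [EE, PP]
  | succ n ih =>
    simp only [EE]
    rw [PP, Finset.prod_range_succ, ← PP, ← ih, mul_comm, ← EE_mul]
    congr 1; funext j
    have e1 : ((m + (j + 1)).choose (j + 1) : ℝ) = (m + j).choose j + (m + j).choose (j + 1) := by
      rw [← add_assoc, Nat.choose_succ_succ]; push_cast; ring
    have e2 : ((m + j).choose (j + 1) : ℝ) * (j + 1) = (m + j).choose j * m := by
      have := Nat.choose_succ_right_eq (m + j) j
      rw [Nat.add_sub_cancel] at this
      exact_mod_cast this
    rw [e1]
    have : ((n:ℝ) + 1) ≠ 0 := by positivity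
    field_simp
    linear_combination ν * e2

lemma EE_geom (ν : ℝ) (n : ℕ) (x : ℝ) (hx : |x| < 1) :
    HasSum (fun m : ℕ => x ^ m * PP n (m * ν)) (EE ν n (fun j => (1 / (1 - x)) ^ (j + 1))) := by
  have := EE_hasSum ν n (fun m j => x ^ m * ((m + j).choose j : ℝ)) (fun j => (1 / (1 - x)) ^ (j + 1))
    (fun j => by
      have := hasSum_choose_mul_geometric_of_norm_lt_one j (r := x) (by simpa using hx)
      rw [one_div_pow]
      simpa [mul_comm] using this)
  simpa only [EE_mul, EE_choose] using this

noncomputable def RR (n : ℕ) (a : ℝ) : ℝ := PP n a / (n : ℝ) ^ a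

lemma PP_pos (n : ℕ) (a : ℝ) (ha : 0 ≤ a) : 0 < PP n a :=
  Finset.prod_pos fun j _ => by positivity

lemma RR_nonneg (n : ℕ) (a : ℝ) (ha : 0 ≤ a) : 0 ≤ RR n a :=
  div_nonneg (PP_pos n a ha).le (by positivity)

lemma RR_anti (a : ℝ) (ha : 0 ≤ a) (n : ℕ) (hn : 1 ≤ n) : RR (n + 1) a ≤ RR n a := by
  have hn' : (0:ℝ) < n := by exact_mod_cast hn
  unfold RR
  rw [PP, Finset.prod_range_succ, ← PP, div_le_div_iff₀ (by positivity) (by positivity), mul_assoc]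
  refine mul_le_mul_of_nonneg_left ?_ (PP_pos n a ha).le
  push_cast
  have h1 : ((n:ℝ) + 1) ^ a = (n:ℝ) ^ a * (((n:ℝ) + 1) / n) ^ a := by
    rw [← Real.mul_rpow (by positivity) (by positivity)]; congr 1; field_simp
  rw [h1, mul_comm]
  refine mul_le_mul_of_nonneg_left ?_ (by positivity)
  rw [Real.rpow_def_of_pos (by positivity)]
  have h2 := Real.one_sub_inv_le_log_of_pos (x := ((n:ℝ) + 1) / n) (by positivity)
  have h3 : 1 - (((n:ℝ) + 1) / n)⁻¹ = 1 / (n + 1) := by field_simp; ring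
  rw [h3] at h2
  have h4 := Real.add_one_le_exp (Real.log (((n:ℝ) + 1) / n) * a)
  have h5 : a / ((n:ℝ) + 1) = 1 / (n + 1) * a := by ring
  rw [h5]
  nlinarith [mul_le_mul_of_nonneg_right h2 ha]

lemma RR_anti' (a : ℝ) (ha : 0 ≤ a) (n m : ℕ) (hn : 1 ≤ n) (h : n ≤ m) : RR m a ≤ RR n a := by
  induction m, h using Nat.le_induction with
  | base => exact le_rfl
  | succ m hm ih => exact (RR_anti a ha m (hn.trans hm)).trans ih

lemma RR_tendsto (a : ℝ) (ha : 0 ≤ a) :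
    Filter.Tendsto (fun n => RR n a) Filter.atTop (nhds (1 / Real.Gamma (a + 1))) := by
  rcases ha.eq_or_lt with rfl | ha
  · simp [RR, PP]
  have h := (Real.GammaSeq_tendsto_Gamma a).const_mul a
  rw [← Real.Gamma_add_one ha.ne'] at h
  have h2 := h.inv₀ (Real.Gamma_pos_of_pos (by linarith)).ne'
  rw [one_div]
  refine h2.congr fun n => ?_
  unfold RR PP Real.GammaSeq
  rw [Finset.prod_range_succ']
  have : ∏ j ∈ Finset.range n, (a + ((j + 1 : ℕ) : ℝ)) = (n.factorial : ℝ) * ∏ j ∈ Finset.range n, (1 + a / ((j:ℝ) + 1)) := by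
    rw [← Finset.prod_range_add_one_eq_factorial]
    push_cast
    rw [← Finset.prod_mul_distrib]
    refine Finset.prod_congr rfl fun j _ => ?_
    field_simp; ring
  rw [this]
  have := n.factorial_pos
  have : (n.factorial : ℝ) ≠ 0 := by positivity
  simp only [Nat.cast_zero, add_zero]
  rw [← mul_div_assoc, inv_div]
  have h1 : a * ((n:ℝ) ^ a * n.factorial) = (a * n.factorial) * (n:ℝ)^a := by ring
  rw [h1, mul_right_comm, mul_comm (n.factorial : ℝ) a]
  rw [mul_div_mul_left _ _ (mul_ne_zero ha.ne' this)]

lemma RR_le (ν : ℝ) (h0 : 0 < ν) (h1 : ν ≤ 1) (n m : ℕ) (hn : 1 ≤ n) :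
    RR n (m * ν) ≤ ((m:ℝ) + 1) ^ n * (((n:ℝ) ^ ν)⁻¹) ^ m := by
  unfold RR
  rw [div_eq_mul_inv, mul_comm (m:ℝ) ν, Real.rpow_mul (by positivity), Real.rpow_natCast, inv_pow]
  refine mul_le_mul_of_nonneg_right ?_ (by positivity)
  unfold PP
  refine (Finset.prod_le_prod (g := fun _ => (m:ℝ) + 1) (fun j _ => by positivity) (fun j _ => ?_)).trans ?_
  · have : ν * m / ((j:ℝ) + 1) ≤ m := by
      rw [div_le_iff₀ (by positivity)]
      have : (0:ℝ) ≤ m * j := by positivity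
      have : (0:ℝ) ≤ m := by positivity
      nlinarith
    linarith
  · simp

lemma exists_N (ν : ℝ) (h0 : 0 < ν) (y : ℝ) : ∃ N : ℕ, 1 ≤ N ∧ y < (N:ℝ) ^ ν := by
  have := (tendsto_rpow_atTop h0).comp tendsto_natCast_atTop_atTop
  obtain ⟨N, h1, h2⟩ := ((this.eventually_gt_atTop y).and (Filter.eventually_ge_atTop 1)).exists
  exact ⟨N, h2, h1⟩

lemma RR_summable (ν : ℝ) (h0 : 0 < ν) (h1 : ν ≤ 1) (y : ℝ) (hy : 0 ≤ y) (n : ℕ) (hn : 1 ≤ n)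
    (h : y < (n:ℝ) ^ ν) : Summable (fun m : ℕ => y ^ m * RR n (m * ν)) := by
  have hpos : 0 < (n:ℝ) ^ ν := lt_of_le_of_lt hy h
  obtain ⟨r, hr1, hr2⟩ : ∃ r, 0 < r ∧ r < 1 ∧ y * ((n:ℝ) ^ ν)⁻¹ ≤ r := by
    have : y * ((n:ℝ) ^ ν)⁻¹ < 1 := by rw [← div_eq_mul_inv, div_lt_one hpos]; exact h
    refine ⟨max (y * ((n:ℝ) ^ ν)⁻¹) (1/2), by positivity, max_lt this (by norm_num), le_max_left _ _⟩
  have hs := summable_pow_mul_geometric_of_norm_lt_one n (r := r) (by rw [Real.norm_of_nonneg hr1.le]; exact hr2.1)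
  have hs2 := ((summable_nat_add_iff 1).2 hs).mul_left r⁻¹
  refine Summable.of_nonneg_of_le (fun m => mul_nonneg (by positivity) (RR_nonneg _ _ (by positivity))) (fun m => ?_) hs2
  calc y ^ m * RR n (m * ν) ≤ y ^ m * (((m:ℝ) + 1) ^ n * (((n:ℝ) ^ ν)⁻¹) ^ m) :=
        mul_le_mul_of_nonneg_left (RR_le ν h0 h1 n m hn) (by positivity)
    _ = ((m:ℝ) + 1) ^ n * (y * ((n:ℝ) ^ ν)⁻¹) ^ m := by rw [mul_pow]; ring
    _ ≤ ((m:ℝ) + 1) ^ n * r ^ m := by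
        refine mul_le_mul_of_nonneg_left (pow_le_pow_left₀ (by positivity) hr2.2 m) (by positivity)
    _ = _ := by push_cast; rw [pow_succ]; field_simp

lemma invGamma_le (a : ℝ) (ha : 0 ≤ a) (n : ℕ) (hn : 1 ≤ n) : 1 / Real.Gamma (a + 1) ≤ RR n a :=
  le_of_tendsto (RR_tendsto a ha) (Filter.eventually_atTop.2 ⟨n, fun m hm => RR_anti' a ha n m hn hm⟩)

lemma ML_summable (ν : ℝ) (h0 : 0 < ν) (h1 : ν ≤ 1) (x : ℝ) :
    Summable (fun k : ℕ => x ^ k / Real.Gamma ((k : ℝ) * ν + 1)) := by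
  obtain ⟨N, hN, hx⟩ := exists_N ν h0 |x|
  refine Summable.of_norm_bounded (RR_summable ν h0 h1 |x| (abs_nonneg _) N hN hx) fun m => ?_
  rw [div_eq_mul_one_div, norm_mul, norm_pow, Real.norm_eq_abs, Real.norm_of_nonneg (by have := Real.Gamma_nonneg_of_nonneg (s := m * ν + 1) (by positivity); positivity)]
  exact mul_le_mul_of_nonneg_left (invGamma_le _ (by positivity) N hN) (by positivity)

lemma ML_tendsto (ν : ℝ) (h0 : 0 < ν) (h1 : ν ≤ 1) (y : ℝ) (hy : 0 ≤ y) :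
    Filter.Tendsto (fun n : ℕ => EE ν n (fun j => Real.exp (-(y * ((j + 1) / (n:ℝ) ^ ν)))))
      Filter.atTop (nhds (ML ν (-y))) := by
  have hT : Filter.Tendsto (fun n : ℕ => (n:ℝ) ^ ν) Filter.atTop Filter.atTop :=
    (tendsto_rpow_atTop h0).comp tendsto_natCast_atTop_atTop
  have hder : Filter.Tendsto (fun n : ℕ => (1 - Real.exp (y / (n:ℝ) ^ ν)) * (n:ℝ) ^ ν) Filter.atTop (nhds (-y)) := by
    have hd : HasDerivAt (fun s : ℝ => Real.exp (y * s)) y 0 := by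
      have := ((hasDerivAt_id (0:ℝ)).const_mul y).exp
      simpa using this
    have h2 := hd.tendsto_slope_zero_right
    have h3 : Filter.Tendsto (fun n : ℕ => ((n:ℝ) ^ ν)⁻¹) Filter.atTop (nhdsWithin 0 (Set.Ioi 0)) :=
      tendsto_inv_atTop_nhdsGT_zero.comp hT
    refine (h2.comp h3).neg.congr fun n => ?_
    simp [div_eq_mul_inv]; ring
  obtain ⟨N, hN, hyN⟩ := exists_N ν h0 (y + 1)
  have hb := RR_summable ν h0 h1 (y + 1) (by linarith) N hN hyN
  have hmain : Filter.Tendsto (fun n : ℕ => ∑' m : ℕ, ((1 - Real.exp (y / (n:ℝ) ^ ν)) * (n:ℝ) ^ ν) ^ m * RR n (m * ν))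
      Filter.atTop (nhds (ML ν (-y))) := by
    unfold ML
    refine tendsto_tsum_of_dominated_convergence hb (fun m => ?_) ?_
    · rw [div_eq_mul_one_div]
      exact (hder.pow m).mul (RR_tendsto _ (by positivity))
    · have e1 : ∀ᶠ n : ℕ in Filter.atTop, |(1 - Real.exp (y / (n:ℝ) ^ ν)) * (n:ℝ) ^ ν| < y + 1 := by
        have := hder.abs
        refine this.eventually_lt_const ?_
        rw [abs_neg, abs_of_nonneg hy]; linarith
      filter_upwards [e1, Filter.eventually_ge_atTop N] with n hn hn2 m
      rw [norm_mul, norm_pow, Real.norm_eq_abs, Real.norm_of_nonneg (RR_nonneg _ _ (by positivity))]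
      exact mul_le_mul (pow_le_pow_left₀ (abs_nonneg _) hn.le m) (RR_anti' _ (by positivity) N n hN hn2)
        (RR_nonneg _ _ (by positivity)) (by positivity)
  refine hmain.congr' ?_
  have e2 : ∀ᶠ n : ℕ in Filter.atTop, |1 - Real.exp (y / (n:ℝ) ^ ν)| < 1 := by
    have : Filter.Tendsto (fun n : ℕ => |1 - Real.exp (y / (n:ℝ) ^ ν)|) Filter.atTop (nhds |1 - Real.exp 0|) := by
      have h3 : Filter.Tendsto (fun n : ℕ => y / (n:ℝ) ^ ν) Filter.atTop (nhds 0) := hT.const_div_atTop y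
      exact ((h3.rexp).const_sub 1).abs
    refine this.eventually_lt_const ?_
    simp
  filter_upwards [e2, Filter.eventually_ge_atTop 1] with n hn hn1
  have hn0 : (0:ℝ) < n := by exact_mod_cast hn1
  have := (EE_geom ν n _ hn).tsum_eq
  have e3 : (fun j : ℕ => Real.exp (-(y * (((j:ℝ) + 1) / (n:ℝ) ^ ν)))) = (fun j : ℕ => (1 / (1 - (1 - Real.exp (y / (n:ℝ) ^ ν)))) ^ (j + 1)) := by
    funext j
    rw [sub_sub_cancel, one_div, ← Real.exp_neg, ← Real.exp_nat_mul]
    congr 1; push_cast; ring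
  rw [e3, ← this]
  refine tsum_congr fun m => ?_
  unfold RR
  rw [mul_pow, mul_comm (m:ℝ) ν, Real.rpow_mul hn0.le, Real.rpow_natCast]
  have : ((n:ℝ) ^ ν) ^ m ≠ 0 := by positivity
  field_simp

/-- `g` has limiting expectation `L` under the scaled chain. -/
def Lim (ν : ℝ) (g : ℝ → ℝ) (L : ℝ) : Prop :=
  Filter.Tendsto (fun n : ℕ => EE ν n (fun j => g ((j + 1) / (n:ℝ) ^ ν))) Filter.atTop (nhds L)

lemma Lim.add {ν : ℝ} {f g : ℝ → ℝ} {a b : ℝ} (hf : Lim ν f a) (hg : Lim ν g b) :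
    Lim ν (fun y => f y + g y) (a + b) :=
  (Filter.Tendsto.add hf hg).congr fun n => (EE_add ν n _ _).symm

lemma Lim.mul {ν : ℝ} {f : ℝ → ℝ} {a : ℝ} (c : ℝ) (hf : Lim ν f a) :
    Lim ν (fun y => c * f y) (c * a) :=
  (Filter.Tendsto.const_mul c hf).congr fun n => (EE_mul ν n _ _).symm

lemma Lim.one {ν : ℝ} : Lim ν (fun _ => 1) 1 := by
  unfold Lim
  simp only [EE_one]
  exact tendsto_const_nhds

lemma Lim.sub {ν : ℝ} {f g : ℝ → ℝ} {a b : ℝ} (hf : Lim ν f a) (hg : Lim ν g b) :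
    Lim ν (fun y => f y - g y) (a - b) := by
  have := hf.add (hg.mul (-1))
  convert this using 1
  · funext y; ring
  · ring

lemma Lim.sum {ν : ℝ} (s : Finset ℕ) {f : ℕ → ℝ → ℝ} {a : ℕ → ℝ} (h : ∀ i ∈ s, Lim ν (f i) (a i)) :
    Lim ν (fun y => ∑ i ∈ s, f i y) (∑ i ∈ s, a i) := by
  induction s using Finset.induction_on with
  | empty => simpa using (Lim.one (ν := ν)).mul 0
  | insert i s hi ih =>
    simp only [Finset.sum_insert hi]
    exact (h i (by simp)).add (ih fun j hj => h j (by simp [hj]))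

lemma Lim.nonneg {ν : ℝ} (h0 : 0 < ν) (h1 : ν ≤ 1) {f : ℝ → ℝ} {a : ℝ} (hf : Lim ν f a)
    (h : ∀ y, 0 ≤ y → 0 ≤ f y) : 0 ≤ a :=
  ge_of_tendsto' hf fun n => EE_nonneg ν h0 h1 n _ fun j _ => h _ (by positivity)

lemma Lim.le_one {ν : ℝ} (h0 : 0 < ν) (h1 : ν ≤ 1) {f : ℝ → ℝ} {a : ℝ} (hf : Lim ν f a)
    (h : ∀ y, 0 ≤ y → f y ≤ 1) : a ≤ 1 := by
  have := (Lim.one.sub hf).nonneg h0 h1 fun y hy => by linarith [h y hy]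
  linarith

lemma Lim.ML {ν : ℝ} (h0 : 0 < ν) (h1 : ν ≤ 1) (c s : ℝ) (hc : 0 ≤ c) (hs : 0 ≤ s) :
    Lim ν (fun y => Real.exp (-c * (s * y))) (ML ν (-c * s)) := by
  have := ML_tendsto ν h0 h1 (c * s) (by positivity)
  unfold Lim
  convert this using 6
  · ring
  · ring

/-- classical state probabilities -/
lemma binom_id (m : ℕ) (w : ℝ) :
    ∑ i ∈ Finset.range (m + 1), (m.choose i : ℝ) * (-1) ^ i * w ^ i = (1 - w) ^ m := by
  rw [sub_eq_neg_add, add_pow]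
  refine Finset.sum_congr rfl fun i _ => ?_
  rw [neg_pow w]; ring

lemma classical_bound (α lam : ℝ) (hα : 0 < α) (hlam : 0 < lam)
    (hne : ∀ k : ℕ, 1 ≤ k → (k : ℝ) * lam ≠ α) (m : ℕ) (y : ℝ) (hy : 0 ≤ y) :
    0 ≤ ∑ i ∈ Finset.range (m + 1), (m.choose i : ℝ) * (-1) ^ (i + 1) * (α / (((i + 1 : ℕ) : ℝ) * lam - α)) *
      (Real.exp (-(((i + 1 : ℕ) : ℝ) * lam) * y) - Real.exp (-α * y)) ∧
    ∑ i ∈ Finset.range (m + 1), (m.choose i : ℝ) * (-1) ^ (i + 1) * (α / (((i + 1 : ℕ) : ℝ) * lam - α)) *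
      (Real.exp (-(((i + 1 : ℕ) : ℝ) * lam) * y) - Real.exp (-α * y)) ≤ 1 := by
  set H : ℝ → ℝ := fun x => ∑ i ∈ Finset.range (m + 1),
    (m.choose i : ℝ) * (-1) ^ (i + 1) * (α / (((i + 1 : ℕ) : ℝ) * lam - α)) *
      Real.exp (-(((i + 1 : ℕ) : ℝ) * lam - α) * x) with hH
  have hd : ∀ x, HasDerivAt H (α * Real.exp (α * x) * (Real.exp (-lam * x) * (1 - Real.exp (-lam * x)) ^ m)) x := by
    intro x
    have : HasDerivAt H (∑ i ∈ Finset.range (m + 1),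
      (m.choose i : ℝ) * (-1) ^ (i + 1) * (α / (((i + 1 : ℕ) : ℝ) * lam - α)) *
      (Real.exp (-(((i + 1 : ℕ) : ℝ) * lam - α) * x) * (-(((i + 1 : ℕ) : ℝ) * lam - α) * 1))) x := by
      rw [hH]
      refine HasDerivAt.fun_sum fun i _ => HasDerivAt.const_mul _ ?_
      exact ((hasDerivAt_id x).const_mul _).exp
    convert this using 1
    rw [← binom_id, Finset.mul_sum, Finset.mul_sum]
    refine Finset.sum_congr rfl fun i _ => ?_
    have hne' : ((i + 1 : ℕ) : ℝ) * lam - α ≠ 0 := sub_ne_zero.2 (hne (i + 1) (by omega))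
    have e : Real.exp (-(((i + 1 : ℕ) : ℝ) * lam - α) * x) = Real.exp (α * x) * (Real.exp (-lam * x) * Real.exp (-lam * x) ^ i) := by
      rw [← pow_succ', ← Real.exp_nat_mul, ← Real.exp_add]; congr 1; push_cast; ring
    rw [e]
    have : (m.choose i : ℝ) * (-1) ^ (i + 1) * (α / (((i + 1 : ℕ) : ℝ) * lam - α)) *
      (Real.exp (α * x) * (Real.exp (-lam * x) * Real.exp (-lam * x) ^ i) * (-(((i + 1 : ℕ) : ℝ) * lam - α) * 1))
      = (m.choose i : ℝ) * (-1) ^ i * (α / (((i + 1 : ℕ) : ℝ) * lam - α) * (((i + 1 : ℕ) : ℝ) * lam - α)) *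
      (Real.exp (α * x) * (Real.exp (-lam * x) * Real.exp (-lam * x) ^ i)) := by ring
    rw [this, div_mul_cancel₀ _ hne']; ring
  have hp : ∑ i ∈ Finset.range (m + 1), (m.choose i : ℝ) * (-1) ^ (i + 1) * (α / (((i + 1 : ℕ) : ℝ) * lam - α)) *
      (Real.exp (-(((i + 1 : ℕ) : ℝ) * lam) * y) - Real.exp (-α * y)) = Real.exp (-α * y) * (H y - H 0) := by
    rw [hH]
    simp only
    rw [← Finset.sum_sub_distrib, Finset.mul_sum]
    refine Finset.sum_congr rfl fun i _ => ?_
    have : Real.exp (-(((i + 1 : ℕ) : ℝ) * lam) * y) = Real.exp (-α * y) * Real.exp (-(((i + 1 : ℕ) : ℝ) * lam - α) * y) := by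
      rw [← Real.exp_add]; congr 1; ring
    rw [this, mul_zero, Real.exp_zero]; ring
  rw [hp]
  have hw : ∀ x, 0 ≤ x → 0 < Real.exp (-lam * x) ∧ Real.exp (-lam * x) ≤ 1 := fun x hx =>
    ⟨Real.exp_pos _, Real.exp_le_one_iff.2 (by nlinarith)⟩
  have m1 : MonotoneOn H (Set.Ici 0) := by
    refine monotoneOn_of_deriv_nonneg (convex_Ici 0) (fun x _ => (hd x).continuousAt.continuousWithinAt)
      (fun x _ => (hd x).differentiableAt.differentiableWithinAt) fun x hx => ?_
    rw [interior_Ici] at hx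
    rw [(hd x).deriv]
    obtain ⟨a, b⟩ := hw x (le_of_lt hx)
    have : 0 ≤ 1 - Real.exp (-lam * x) := by linarith
    positivity
  have hd2 : ∀ x, HasDerivAt (fun x => Real.exp (α * x) - H x) (α * Real.exp (α * x) - α * Real.exp (α * x) * (Real.exp (-lam * x) * (1 - Real.exp (-lam * x)) ^ m)) x := by
    intro x
    have := ((hasDerivAt_id x).const_mul α).exp
    refine HasDerivAt.sub ?_ (hd x)
    simp only [id, mul_one] at this
    rw [mul_comm α (Real.exp (α * x))]
    exact this
  have m2 : MonotoneOn (fun x => Real.exp (α * x) - H x) (Set.Ici 0) := by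
    refine monotoneOn_of_deriv_nonneg (convex_Ici 0) (fun x _ => (hd2 x).continuousAt.continuousWithinAt)
      (fun x _ => (hd2 x).differentiableAt.differentiableWithinAt) fun x hx => ?_
    rw [interior_Ici] at hx
    rw [(hd2 x).deriv]
    obtain ⟨a, b⟩ := hw x (le_of_lt hx)
    have h1 : 0 ≤ 1 - Real.exp (-lam * x) := by linarith
    have h2 : (1 - Real.exp (-lam * x)) ^ m ≤ 1 := pow_le_one₀ h1 (by linarith)
    have h3 : Real.exp (-lam * x) * (1 - Real.exp (-lam * x)) ^ m ≤ 1 := mul_le_one₀ b (by positivity) h2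
    have h4 : 0 ≤ α * Real.exp (α * x) := by positivity
    nlinarith
  have k1 := m1 (Set.mem_Ici.2 le_rfl) (Set.mem_Ici.2 hy) hy
  have k2 := m2 (Set.mem_Ici.2 le_rfl) (Set.mem_Ici.2 hy) hy
  simp only [mul_zero, Real.exp_zero] at k2
  have hE : Real.exp (-α * y) * Real.exp (α * y) = 1 := by rw [← Real.exp_add]; simp
  have hpos := Real.exp_pos (-α * y)
  constructor
  · exact mul_nonneg hpos.le (by linarith)
  · nlinarith

lemma pbar_succ (ν α lam : ℝ) (m : ℕ) (t : ℝ) : pbar ν α lam (m + 1) t =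
    ∑ i ∈ Finset.range (m + 1), (m.choose i : ℝ) * (-1) ^ (i + 1) * (α / (((i + 1 : ℕ) : ℝ) * lam - α)) *
      (ML ν (-(((i + 1 : ℕ) : ℝ) * lam) * t ^ ν) - ML ν (-α * t ^ ν)) := by
  unfold pbar
  have := Finset.sum_Ico_add' (fun k : ℕ => ((m).choose (k - 1) : ℝ) * (-1 : ℝ) ^ k * (α / ((k : ℝ) * lam - α)) *
      (ML ν (-((k : ℝ) * lam) * t ^ ν) - ML ν (-α * t ^ ν))) 0 (m+1) 1
  rw [if_neg (by omega), Finset.range_eq_Ico]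
  exact this.symm

lemma ML_bound {ν : ℝ} (h0 : 0 < ν) (h1 : ν ≤ 1) (c s : ℝ) (hc : 0 ≤ c) (hs : 0 ≤ s) :
    0 ≤ ML ν (-c * s) ∧ ML ν (-c * s) ≤ 1 := by
  have := Lim.ML h0 h1 c s hc hs
  refine ⟨this.nonneg h0 h1 fun y _ => (Real.exp_pos _).le, this.le_one h0 h1 fun y hy => ?_⟩
  rw [Real.exp_le_one_iff]
  have : 0 ≤ c * (s * y) := by positivity
  linarith

lemma pbar_bound {ν α lam : ℝ} (h0 : 0 < ν) (h1 : ν ≤ 1) (hα : 0 < α) (hlam : 0 < lam)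
    (hne : ∀ k : ℕ, 1 ≤ k → (k : ℝ) * lam ≠ α) (n : ℕ) (t : ℝ) (ht : 0 ≤ t) :
    |pbar ν α lam n t| ≤ 1 := by
  have hs : 0 ≤ t ^ ν := by positivity
  have key : 0 ≤ pbar ν α lam n t ∧ pbar ν α lam n t ≤ 1 := by
    rcases n with _ | m
    · simp only [pbar, if_true]
      exact ML_bound h0 h1 α _ hα.le hs
    · rw [pbar_succ]
      have hL := Lim.sum (ν := ν) (Finset.range (m + 1)) (fun i _ =>
        ((Lim.ML h0 h1 (((i + 1 : ℕ) : ℝ) * lam) (t ^ ν) (by positivity) hs).sub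
          (Lim.ML h0 h1 α (t ^ ν) hα.le hs)).mul
          ((m.choose i : ℝ) * (-1) ^ (i + 1) * (α / (((i + 1 : ℕ) : ℝ) * lam - α))))
      exact ⟨hL.nonneg h0 h1 fun y hy => (classical_bound α lam hα hlam hne m _ (by positivity)).1,
        hL.le_one h0 h1 fun y hy => (classical_bound α lam hα hlam hne m _ (by positivity)).2⟩
  rw [abs_le]; exact ⟨by linarith [key.1], key.2⟩

lemma ML_measurable {ν : ℝ} (h0 : 0 < ν) (h1 : ν ≤ 1) : Measurable (ML ν) := by
  refine measurable_of_tendsto_metrizable (f := fun (n : ℕ) x => ∑ k ∈ Finset.range n, x ^ k / Real.Gamma ((k : ℝ) * ν + 1))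
    (fun n => by fun_prop) ?_
  rw [tendsto_pi_nhds]
  exact fun x => (ML_summable ν h0 h1 x).hasSum.tendsto_sum_nat

lemma ML_comp_measurable {ν : ℝ} (h0 : 0 < ν) (h1 : ν ≤ 1) (c : ℝ) :
    Measurable (fun t : ℝ => ML ν (-c * t ^ ν)) :=
  (ML_measurable h0 h1).comp (by fun_prop)

lemma pbar_measurable {ν : ℝ} (α lam : ℝ) (h0 : 0 < ν) (h1 : ν ≤ 1) (n : ℕ) :
    Measurable (pbar ν α lam n) := by
  rcases n with _ | m
  · have : pbar ν α lam 0 = fun t : ℝ => ML ν (-α * t ^ ν) := by funext t; simp [pbar]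
    rw [this]; exact ML_comp_measurable h0 h1 α
  · have : pbar ν α lam (m + 1) = _ := funext fun t => pbar_succ ν α lam m t
    rw [this]
    exact Finset.measurable_fun_sum _ fun i _ => 
      ((ML_comp_measurable h0 h1 _).sub (ML_comp_measurable h0 h1 _)).const_mul _

lemma laplace_integrable {f : ℝ → ℝ} (hf : Measurable f) (hb : ∀ t, 0 ≤ t → |f t| ≤ 1) (z : ℝ) (hz : 0 < z) :
    IntegrableOn (fun t => Real.exp (-z * t) * f t) (Set.Ioi 0) := by
  refine Integrable.mono' (exp_neg_integrableOn_Ioi 0 hz) (by fun_prop) ?_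
  refine (ae_restrict_iff' measurableSet_Ioi).2 (Filter.Eventually.of_forall fun t ht => ?_)
  rw [norm_mul, Real.norm_of_nonneg (Real.exp_pos _).le]
  exact mul_le_of_le_one_right (Real.exp_pos _).le (hb t (le_of_lt ht))

lemma laplace_ML_large {ν : ℝ} (h0 : 0 < ν) (h1 : ν ≤ 1) (c : ℝ) (hc : 0 ≤ c) (z : ℝ) (hz : 0 < z)
    (hcz : c < z ^ ν) :
    ∫ t in Set.Ioi (0:ℝ), Real.exp (-z * t) * ML ν (-c * t ^ ν) = z ^ (ν - 1) / (z ^ ν + c) := by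
  have hzν : 0 < z ^ ν := by positivity
  set F : ℕ → ℝ → ℝ := fun k t => ((-c) ^ k / Real.Gamma (k * ν + 1)) * (t ^ ((k * ν + 1 : ℝ) - 1) * Real.exp (-(z * t))) with hF
  have hG : ∀ k : ℕ, 0 < Real.Gamma (k * ν + 1) := fun k => Real.Gamma_pos_of_pos (by positivity)
  have hint : ∀ k : ℕ, ∫ t in Set.Ioi (0:ℝ), (t ^ ((k * ν + 1 : ℝ) - 1) * Real.exp (-(z * t))) = (1 / z) ^ ((k:ℝ) * ν + 1) * Real.Gamma (k * ν + 1) :=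
    fun k => Real.integral_rpow_mul_exp_neg_mul_Ioi (by positivity) hz
  have hI : ∀ k : ℕ, IntegrableOn (fun t : ℝ => t ^ ((k * ν + 1 : ℝ) - 1) * Real.exp (-(z * t))) (Set.Ioi 0) := by
    intro k
    have := integrableOn_rpow_mul_exp_neg_mul_rpow (p := 1) (s := k * ν + 1 - 1) (b := z)
      (by have : (0:ℝ) ≤ k * ν := by positivity
          linarith) one_pos hz
    simpa using this
  have hpow : ∀ k : ℕ, (1 / z) ^ ((k:ℝ) * ν + 1) = z⁻¹ * ((z ^ ν)⁻¹) ^ k := by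
    intro k
    rw [one_div, Real.rpow_add (by positivity), Real.rpow_one, mul_comm (k:ℝ) ν, Real.rpow_mul (by positivity), Real.rpow_natCast,
      Real.inv_rpow hz.le, mul_comm]
  have hsum : HasSum (fun k => ∫ t in Set.Ioi (0:ℝ), F k t) (∫ t in Set.Ioi (0:ℝ), ∑' k, F k t) := by
    refine hasSum_integral_of_summable_integral_norm (fun k => (hI k).const_mul _) ?_
    have : ∀ k : ℕ, ∫ t in Set.Ioi (0:ℝ), ‖F k t‖ = z⁻¹ * (c * (z ^ ν)⁻¹) ^ k := by
      intro k
      have e : ∫ t in Set.Ioi (0:ℝ), ‖F k t‖ = ∫ t in Set.Ioi (0:ℝ), (c ^ k / Real.Gamma (k * ν + 1)) * (t ^ ((k * ν + 1 : ℝ) - 1) * Real.exp (-(z * t))) := by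
        refine setIntegral_congr_fun measurableSet_Ioi fun t ht => ?_
        have ht' : (0:ℝ) < t := ht
        simp only [hF]
        rw [norm_mul, norm_div, norm_pow, norm_neg, Real.norm_of_nonneg hc, Real.norm_of_nonneg (hG k).le, Real.norm_of_nonneg (by positivity)]
      rw [e, integral_const_mul, hint, hpow, mul_pow]
      have := (hG k).ne'
      field_simp
    simp only [this]
    refine (summable_geometric_of_lt_one (by positivity) ?_).mul_left _
    rw [← div_eq_mul_inv, div_lt_one hzν]; exact hcz
  have hv : ∀ k : ℕ, ∫ t in Set.Ioi (0:ℝ), F k t = z⁻¹ * (-c * (z ^ ν)⁻¹) ^ k := by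
    intro k
    simp only [hF]
    rw [integral_const_mul, hint, hpow, mul_pow]
    have := (hG k).ne'
    field_simp
  simp only [hv] at hsum
  have hgeo : HasSum (fun k : ℕ => z⁻¹ * (-c * (z ^ ν)⁻¹) ^ k) (z⁻¹ * (1 - (-c * (z ^ ν)⁻¹))⁻¹) := by
    refine (hasSum_geometric_of_abs_lt_one ?_).mul_left _
    rw [abs_mul, abs_neg, abs_of_nonneg hc, abs_of_nonneg (by positivity), ← div_eq_mul_inv, div_lt_one hzν]; exact hcz
  have e := hsum.unique hgeo
  have e2 : ∫ t in Set.Ioi (0:ℝ), ∑' k, F k t = ∫ t in Set.Ioi (0:ℝ), Real.exp (-z * t) * ML ν (-c * t ^ ν) := by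
    refine setIntegral_congr_fun measurableSet_Ioi fun t ht => ?_
    have ht' : (0:ℝ) < t := ht
    simp only [hF, ML]
    rw [← tsum_mul_left]
    refine tsum_congr fun k => ?_
    rw [mul_pow, ← Real.rpow_natCast (t ^ ν), ← Real.rpow_mul ht'.le, add_sub_cancel_right, mul_comm ν (k:ℝ), neg_mul]
    ring
  rw [← e2, e, Real.rpow_sub_one hz.ne']
  have : z ^ ν + c ≠ 0 := by positivity
  have h3 : 1 - (-c * (z ^ ν)⁻¹) = (z ^ ν + c) / z ^ ν := by field_simp; ring
  rw [h3, inv_div]; field_simp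

lemma laplace_ML {ν : ℝ} (h0 : 0 < ν) (h1 : ν ≤ 1) (c : ℝ) (hc : 0 ≤ c) (z : ℝ) (hz : 0 < z) :
    ∫ t in Set.Ioi (0:ℝ), Real.exp (-z * t) * ML ν (-c * t ^ ν) = z ^ (ν - 1) / (z ^ ν + c) := by
  set f : ℝ → ℝ := fun t => ML ν (-c * t ^ ν) with hf
  have hfm : Measurable f := ML_comp_measurable h0 h1 c
  have hfb : ∀ t, 0 ≤ t → 0 ≤ f t ∧ f t ≤ 1 := fun t ht => ML_bound h0 h1 c _ hc (by positivity)
  set μ : Measure ℝ := (volume.restrict (Set.Ioi 0)).withDensity (fun t => ENNReal.ofReal (f t)) with hμ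
  have hmgf : ∀ s, ProbabilityTheory.mgf id μ s = ∫ t in Set.Ioi (0:ℝ), Real.exp (s * t) * f t := by
    intro s
    unfold ProbabilityTheory.mgf
    rw [hμ, integral_withDensity_eq_integral_toReal_smul (by fun_prop) (by simp)]
    refine setIntegral_congr_fun measurableSet_Ioi fun t ht => ?_
    simp only [id, smul_eq_mul]
    rw [ENNReal.toReal_ofReal (hfb t (le_of_lt ht)).1, mul_comm]
  have hset : Set.Iio (0:ℝ) ⊆ interior (ProbabilityTheory.integrableExpSet id μ) := by
    refine interior_maximal (fun s hs => ?_) isOpen_Iio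
    have hs' : 0 < -s := by simpa using hs
    unfold ProbabilityTheory.integrableExpSet
    rw [Set.mem_ofPred_eq, hμ, integrable_withDensity_iff (by fun_prop) (by simp)]
    refine (integrableOn_congr_fun (fun t ht => ?_) measurableSet_Ioi).1
      (laplace_integrable hfm (fun t ht => by rw [abs_le]; exact ⟨by linarith [(hfb t ht).1], (hfb t ht).2⟩) (-s) hs')
    simp only [id, neg_neg]
    rw [ENNReal.toReal_ofReal (hfb t (le_of_lt ht)).1]
  have hA : AnalyticOnNhd ℝ (fun z => ProbabilityTheory.mgf id μ (-z)) (Set.Ioi 0) := by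
    refine (ProbabilityTheory.analyticOnNhd_mgf.mono hset).comp (analyticOnNhd_id.neg) ?_
    intro x hx
    simpa using hx
  have hB : AnalyticOnNhd ℝ (fun z : ℝ => z ^ (ν - 1) / (z ^ ν + c)) (Set.Ioi 0) := by
    intro x hx
    have hx' : (0:ℝ) < x := hx
    have hr : ∀ p : ℝ, AnalyticAt ℝ (fun y : ℝ => y ^ p) x := fun p =>
      (Real.contDiffAt_rpow_const_of_ne hx'.ne').analyticAt
    refine (hr _).div ((hr _).add analyticAt_const) (by positivity)
  have hT := (tendsto_rpow_atTop h0).eventually_gt_atTop c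
  obtain ⟨z₀, hz₀, hz₀p⟩ := (hT.and (Filter.eventually_gt_atTop 0)).exists
  have hev : (fun z => ProbabilityTheory.mgf id μ (-z)) =ᶠ[nhds z₀] (fun z : ℝ => z ^ (ν - 1) / (z ^ ν + c)) := by
    have c1 : ∀ᶠ z in nhds z₀, c < z ^ ν :=
      (Real.continuousAt_rpow_const z₀ ν (Or.inr h0.le)).eventually_const_lt hz₀
    filter_upwards [c1, eventually_gt_nhds hz₀p] with z hz1 hz2
    rw [hmgf]
    exact laplace_ML_large h0 h1 c hc z hz2 hz1
  have := hA.eqOn_of_preconnected_of_eventuallyEq hB isPreconnected_Ioi hz₀p hev hz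
  simp only [hmgf] at this
  exact this

lemma rhs_term (lam s : ℝ) (hlam : 0 < lam) (hs : 0 < s) (m : ℕ) :
    ∫ x in Set.Ioi (0:ℝ), Real.exp (-s * x) * (Real.exp (-lam * x) * (1 - Real.exp (-lam * x)) ^ m) =
      ∑ i ∈ Finset.range (m + 1), (m.choose i : ℝ) * (-1) ^ i * (1 / (s + ((i + 1 : ℕ) : ℝ) * lam)) := by
  have e : ∀ x : ℝ, Real.exp (-s * x) * (Real.exp (-lam * x) * (1 - Real.exp (-lam * x)) ^ m) =
      ∑ i ∈ Finset.range (m + 1), (m.choose i : ℝ) * (-1) ^ i * Real.exp (-(s + ((i + 1 : ℕ) : ℝ) * lam) * x) := by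
    intro x
    rw [← binom_id, Finset.mul_sum, Finset.mul_sum]
    refine Finset.sum_congr rfl fun i _ => ?_
    have : Real.exp (-(s + ((i + 1 : ℕ) : ℝ) * lam) * x) = Real.exp (-s * x) * (Real.exp (-lam * x) * Real.exp (-lam * x) ^ i) := by
      rw [← pow_succ', ← Real.exp_nat_mul, ← Real.exp_add]; congr 1; push_cast; ring
    rw [this]; ring
  simp only [e]
  have hp : ∀ i : ℕ, 0 < s + ((i + 1 : ℕ) : ℝ) * lam := fun i => by positivity
  rw [integral_finsetSum _ fun i _ => (exp_neg_integrableOn_Ioi 0 (hp i)).const_mul _]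
  refine Finset.sum_congr rfl fun i _ => ?_
  rw [integral_const_mul, integral_exp_mul_Ioi (by linarith [hp i])]
  rw [mul_zero, Real.exp_zero, neg_div_neg_eq]

lemma laplace_pbar_succ {ν α lam : ℝ} (h0 : 0 < ν) (h1 : ν ≤ 1) (hα : 0 < α) (hlam : 0 < lam)
    (hne : ∀ k : ℕ, 1 ≤ k → (k : ℝ) * lam ≠ α) (m : ℕ) (z : ℝ) (hz : 0 < z) :
    ∫ t in Set.Ioi (0:ℝ), Real.exp (-z * t) * pbar ν α lam (m + 1) t =
      α / (z ^ ν + α) * z ^ (ν - 1) *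
       ∫ x in Set.Ioi (0:ℝ), Real.exp (-z ^ ν * x) * (Real.exp (-lam * x) * (1 - Real.exp (-lam * x)) ^ m) := by
  have hzν : 0 < z ^ ν := by positivity
  have hI : ∀ c, 0 ≤ c → IntegrableOn (fun t => Real.exp (-z * t) * ML ν (-c * t ^ ν)) (Set.Ioi 0) := fun c hc =>
    laplace_integrable (ML_comp_measurable h0 h1 c) (fun t ht => by
      have := ML_bound h0 h1 c (t ^ ν) hc (by positivity)
      rw [abs_le]; exact ⟨by linarith, this.2⟩) z hz
  rw [rhs_term lam _ hlam hzν]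
  have e : ∀ t : ℝ, Real.exp (-z * t) * pbar ν α lam (m + 1) t =
      ∑ i ∈ Finset.range (m + 1), ((m.choose i : ℝ) * (-1) ^ (i + 1) * (α / (((i + 1 : ℕ) : ℝ) * lam - α))) *
      (Real.exp (-z * t) * ML ν (-(((i + 1 : ℕ) : ℝ) * lam) * t ^ ν) - Real.exp (-z * t) * ML ν (-α * t ^ ν)) := by
    intro t
    rw [pbar_succ, Finset.mul_sum]
    exact Finset.sum_congr rfl fun i _ => by ring
  simp only [e]
  have hI2 : ∀ i ∈ Finset.range (m + 1), IntegrableOn (fun t => ((m.choose i : ℝ) * (-1) ^ (i + 1) * (α / (((i + 1 : ℕ) : ℝ) * lam - α))) *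
      (Real.exp (-z * t) * ML ν (-(((i + 1 : ℕ) : ℝ) * lam) * t ^ ν) - Real.exp (-z * t) * ML ν (-α * t ^ ν))) (Set.Ioi 0) :=
    fun i _ => Integrable.const_mul (Integrable.sub (hI (((i + 1 : ℕ) : ℝ) * lam) (by positivity)) (hI _ hα.le)) _
  rw [integral_finsetSum _ hI2, Finset.mul_sum]
  refine Finset.sum_congr rfl fun i _ => ?_
  rw [integral_const_mul, integral_sub (hI _ (by positivity)) (hI _ hα.le), laplace_ML h0 h1 _ (by positivity) z hz,
    laplace_ML h0 h1 _ hα.le z hz]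
  have hne' : ((i + 1 : ℕ) : ℝ) * lam - α ≠ 0 := sub_ne_zero.2 (hne (i + 1) (by omega))
  have h2 : z ^ ν + ((i + 1 : ℕ) : ℝ) * lam ≠ 0 := by positivity
  have h3 : z ^ ν + α ≠ 0 := by positivity
  generalize ((i + 1 : ℕ) : ℝ) * lam = q at *
  rw [pow_succ]
  field_simp
  ring

/-- Laplace transform of the probability generating function of the TFLBPwI. -/
theorem laplace_pgf_pbar (ν α lam : ℝ) (hν0 : 0 < ν) (hν1 : ν ≤ 1) (hα : 0 < α)
    (hlam : 0 < lam) (hne : ∀ k : ℕ, 1 ≤ k → (k : ℝ) * lam ≠ α)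
    (u : ℝ) (hu0 : 0 ≤ u) (hu1 : u < 1) (z : ℝ) (hz : 0 < z) :
    ∫ t in Set.Ioi (0:ℝ), Real.exp (-z * t) * ∑' n : ℕ, u ^ n * pbar ν α lam n t =
      z ^ (ν - 1) / (z ^ ν + α) +
        (α / (z ^ ν + α)) * ∫ x in Set.Ioi (0:ℝ),
          (u * Real.exp (-lam * x) / (1 - u * (1 - Real.exp (-lam * x)))) *
            Real.exp (-x * z ^ ν) * z ^ (ν - 1) := by
  have hzν : 0 < z ^ ν := by positivity
  have gen : ∀ (w : ℝ), 0 < w → ∀ f : ℕ → ℝ → ℝ, (∀ n, Measurable (f n)) → (∀ n t, 0 ≤ t → |f n t| ≤ 1) →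
      HasSum (fun n => u ^ n * ∫ t in Set.Ioi (0:ℝ), Real.exp (-w * t) * f n t)
        (∫ t in Set.Ioi (0:ℝ), Real.exp (-w * t) * ∑' n, u ^ n * f n t) := by
    intro w hw f hfm hfb
    have hI := fun n => laplace_integrable (hfm n) (hfb n) w hw
    have := hasSum_integral_of_summable_integral_norm (μ := volume.restrict (Set.Ioi (0:ℝ)))
      (F := fun n t => u ^ n * (Real.exp (-w * t) * f n t)) (fun n => (hI n).const_mul _) ?_
    · simp only [integral_const_mul] at this
      have e : ∀ t : ℝ, Real.exp (-w * t) * ∑' n, u ^ n * f n t = ∑' n, u ^ n * (Real.exp (-w * t) * f n t) := by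
        intro t
        rw [← tsum_mul_left]
        exact tsum_congr fun n => by ring
      simp only [e]
      exact this
    · refine Summable.of_nonneg_of_le (fun n => integral_nonneg fun t => norm_nonneg _) (fun n => ?_)
        ((summable_geometric_of_lt_one hu0 hu1).mul_right (∫ t in Set.Ioi (0:ℝ), Real.exp (-w * t)))
      rw [← integral_const_mul]
      refine setIntegral_mono_on ((hI n).const_mul _).norm ((exp_neg_integrableOn_Ioi 0 hw).const_mul _) measurableSet_Ioi fun t ht => ?_
      rw [norm_mul, norm_mul, Real.norm_of_nonneg (Real.exp_pos _).le, Real.norm_of_nonneg (by positivity : 0 ≤ u ^ n)]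
      refine mul_le_mul_of_nonneg_left ?_ (by positivity)
      exact mul_le_of_le_one_right (Real.exp_pos _).le (hfb n t (le_of_lt ht))
  have hL := gen z hz (pbar ν α lam) (pbar_measurable α lam hν0 hν1)
    (fun n t ht => pbar_bound hν0 hν1 hα hlam hne n t ht)
  have hw : ∀ x, 0 ≤ x → 0 < Real.exp (-lam * x) ∧ Real.exp (-lam * x) ≤ 1 := fun x hx =>
    ⟨Real.exp_pos _, Real.exp_le_one_iff.2 (by nlinarith)⟩
  have hR := gen (z ^ ν) hzν (fun m x => Real.exp (-lam * x) * (1 - Real.exp (-lam * x)) ^ m)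
    (fun m => by fun_prop) (fun m x hx => by
      obtain ⟨a, b⟩ := hw x hx
      have h1 : 0 ≤ 1 - Real.exp (-lam * x) := by linarith
      have h2 : (1 - Real.exp (-lam * x)) ^ m ≤ 1 := pow_le_one₀ h1 (by linarith)
      rw [abs_of_nonneg (by positivity)]
      exact mul_le_one₀ b (by positivity) h2)
  rw [← hL.tsum_eq, hL.summable.tsum_eq_zero_add]
  congr 1
  · simp only [pbar, if_true, pow_zero, one_mul]
    exact laplace_ML hν0 hν1 α hα.le z hz
  · have e : ∀ m : ℕ, u ^ (m + 1) * ∫ t in Set.Ioi (0:ℝ), Real.exp (-z * t) * pbar ν α lam (m + 1) t =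
        (α / (z ^ ν + α)) * (z ^ (ν - 1) * u) * (u ^ m * ∫ x in Set.Ioi (0:ℝ), Real.exp (-z ^ ν * x) * (Real.exp (-lam * x) * (1 - Real.exp (-lam * x)) ^ m)) := by
      intro m
      rw [laplace_pbar_succ hν0 hν1 hα hlam hne m z hz]; ring
    simp only [e]
    rw [tsum_mul_left, hR.tsum_eq, mul_assoc, ← integral_const_mul]
    congr 1
    refine setIntegral_congr_fun measurableSet_Ioi fun x hx => ?_
    obtain ⟨a, b⟩ := hw x (le_of_lt hx)
    have h1 : 0 ≤ 1 - Real.exp (-lam * x) := by linarith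
    have h2 : u * (1 - Real.exp (-lam * x)) < 1 := by nlinarith
    have h3 : ∑' m : ℕ, u ^ m * (Real.exp (-lam * x) * (1 - Real.exp (-lam * x)) ^ m) =
        Real.exp (-lam * x) * (1 - u * (1 - Real.exp (-lam * x)))⁻¹ := by
      rw [← tsum_geometric_of_lt_one (by positivity) h2, ← tsum_mul_left]
      exact tsum_congr fun m => by rw [mul_pow]; ring
    rw [h3]
    have : -x * z ^ ν = -z ^ ν * x := by ring
    rw [this]; ring
end
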